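/- For all integers n ≥ 3 and 3 ≤ i ≤ n, one has g_n(1i) = g_{n-1} + Σ_{j=2}^{i-1} (q^{i-j} − 1)·g_{n-1}(1j) in ℤ[q]. -/

import Mathlib

open Finset Polynomial

/-- The cycle of `π` starting at `m`: `m, π m, π² m, …` through one full period. -/
noncomputable def cycleList {n : ℕ} (π : Equiv.Perm (Fin n)) (m : Fin n) : List (Fin n) :=
  (List.range (Function.minimalPeriod π m)).map (fun k => (π ^ k) m)

/-- The minima of the cycles of `π`, listed in increasing order. -/
def cycleMins {n : ℕ} (π : Equiv.Perm (Fin n)) : List (Fin n) :=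
  (Finset.univ.filter (fun m : Fin n => ∀ k < n, m ≤ (π ^ k) m)).sort (· ≤ ·)

/-- The flattened permutation of `π`, as a word on the letters `1, …, n`:
erase the parentheses from the standard cycle form of `π`. -/
noncomputable def flattenPerm {n : ℕ} (π : Equiv.Perm (Fin n)) : List ℕ :=
  ((cycleMins π).map (cycleList π)).flatten.map (fun m => (m : ℕ) + 1)

/-- The number of occurrences of the pattern 13-2 in the word `w = w₁w₂⋯wₙ`
(1-based), i.e. the number of pairs `(i,j)` with `2 ≤ i < j ≤ n` and
`w_{i-1} < w_j < w_i`.  Below, `p.1` and `p.2` are the 0-based versions of `i` and `j`. -/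
def occ (w : List ℕ) : ℕ :=
  ((Finset.range w.length ×ˢ Finset.range w.length).filter
    (fun p : ℕ × ℕ => 1 ≤ p.1 ∧ p.1 < p.2 ∧
      w.getD (p.1 - 1) 0 < w.getD p.2 0 ∧ w.getD p.2 0 < w.getD p.1 0)).card

/-- `g_n = Σ_{π ∈ S_n} q^{occ(Flatten(π))} ∈ ℤ[q]`. -/
noncomputable def gPoly (n : ℕ) : Polynomial ℤ :=
  ∑ π : Equiv.Perm (Fin n), X ^ occ (flattenPerm π)

/-- `g_n(a₁⋯a_k)`: the sum of `q^{occ(Flatten(π))}` over the permutations `π` of length `n`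
whose flattened permutation starts with the subword `a₁⋯a_k`. -/
noncomputable def gPrefix (n : ℕ) (w : List ℕ) : Polynomial ℤ :=
  ∑ π ∈ Finset.univ.filter (fun π : Equiv.Perm (Fin n) => w <+: flattenPerm π),
    X ^ occ (flattenPerm π)

/-- `g_{n,r}(a₁⋯a_k)`: the number of permutations `π` of length `n` such that `Flatten(π)`
starts with `a₁⋯a_k` and has exactly `r` occurrences of the pattern 13-2. -/
noncomputable def gCount (n r : ℕ) (w : List ℕ) : ℕ :=
  (Finset.univ.filter (fun π : Equiv.Perm (Fin n) =>
    w <+: flattenPerm π ∧ occ (flattenPerm π) = r)).card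

section flattenHelpers

open Function Equiv

theorem mem_cycleList_iff {n : ℕ} (π : Equiv.Perm (Fin n)) (m y : Fin n) :
    y ∈ cycleList π m ↔ π.SameCycle m y := by
  unfold cycleList
  simp only [List.mem_map, List.mem_range]
  constructor
  · rintro ⟨k, -, rfl⟩
    exact ⟨k, by simp⟩
  · intro h
    obtain ⟨k, -, rfl⟩ := h.exists_pow_eq'
    refine ⟨k % minimalPeriod π m, Nat.mod_lt _
      (minimalPeriod_pos_of_mem_periodicPts (π.injective.mem_periodicPts m)), ?_⟩
    rw [← Equiv.Perm.iterate_eq_pow, ← Equiv.Perm.iterate_eq_pow, iterate_mod_minimalPeriod_eq]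

theorem cycleList_nodup {n : ℕ} (π : Equiv.Perm (Fin n)) (m : Fin n) :
    (cycleList π m).Nodup := by
  unfold cycleList
  refine List.Nodup.map_on ?_ List.nodup_range
  intro a ha b hb h
  rw [← Equiv.Perm.iterate_eq_pow, ← Equiv.Perm.iterate_eq_pow] at h
  exact iterate_injOn_Iio_minimalPeriod (by simpa using ha) (by simpa using hb) h

theorem cycleMin_iff {n : ℕ} (π : Equiv.Perm (Fin n)) (m : Fin n) :
    (∀ k < n, m ≤ (π ^ k) m) ↔ ∀ y, π.SameCycle m y → m ≤ y := by
  constructor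
  · intro h y hy
    rw [← mem_cycleList_iff] at hy
    unfold cycleList at hy
    simp only [List.mem_map, List.mem_range] at hy
    obtain ⟨k, hk, rfl⟩ := hy
    exact h k (hk.trans_le (by simpa using minimalPeriod_le_card (f := π) (x := m)))
  · intro h k _
    exact h _ ⟨k, by simp⟩

theorem mem_cycleMins {n : ℕ} (π : Equiv.Perm (Fin n)) (m : Fin n) :
    m ∈ cycleMins π ↔ ∀ y, π.SameCycle m y → m ≤ y := by
  unfold cycleMins
  rw [Finset.mem_sort, Finset.mem_filter, cycleMin_iff]
  simp

/-- The flattened permutation with letters in `Fin n`. -/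
noncomputable def flatFin {n : ℕ} (π : Equiv.Perm (Fin n)) : List (Fin n) :=
  ((cycleMins π).map (cycleList π)).flatten

theorem flatFin_nodup {n : ℕ} (π : Equiv.Perm (Fin n)) : (flatFin π).Nodup := by
  unfold flatFin
  rw [List.nodup_flatten]
  constructor
  · intro l hl
    obtain ⟨m, -, rfl⟩ := List.mem_map.1 hl
    exact cycleList_nodup π m
  · rw [List.pairwise_map]
    have hnd : (cycleMins π).Nodup := Finset.sort_nodup _ _
    refine List.Pairwise.imp_of_mem ?_ hnd
    intro a b ha hb hab x hx hy
    rw [mem_cycleList_iff] at hx hy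
    rw [mem_cycleMins] at ha hb
    exact hab (le_antisymm (ha _ (hx.trans hy.symm)) (hb _ (hy.trans hx.symm)))

theorem mem_flatFin {n : ℕ} (π : Equiv.Perm (Fin n)) (y : Fin n) : y ∈ flatFin π := by
  classical
  unfold flatFin
  obtain ⟨m, hm, hmin⟩ := Finset.exists_min_image
    (Finset.univ.filter (fun x => π.SameCycle y x)) id ⟨y, by simp [Equiv.Perm.SameCycle.refl]⟩
  simp only [Finset.mem_filter, Finset.mem_univ, true_and, id] at hm hmin
  refine List.mem_flatten.2 ⟨cycleList π m, List.mem_map.2 ⟨m, ?_, rfl⟩, ?_⟩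
  · rw [mem_cycleMins]
    exact fun x hx => hmin x (hm.trans hx)
  · rw [mem_cycleList_iff]; exact hm.symm

theorem cycleMins_pairwise {n : ℕ} (π : Equiv.Perm (Fin n)) :
    (cycleMins π).Pairwise (· < ·) := (Finset.sortedLT_sort _).pairwise

theorem zero_mem_cycleMins {n : ℕ} (π : Equiv.Perm (Fin (n + 1))) : 0 ∈ cycleMins π := by
  rw [mem_cycleMins]; exact fun y _ => Fin.zero_le y

theorem cycleMins_eq_cons {n : ℕ} (π : Equiv.Perm (Fin (n + 1))) :
    ∃ R, cycleMins π = 0 :: R ∧ ∀ m ∈ R, m ≠ 0 := by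
  have h0 := zero_mem_cycleMins π
  have hp := cycleMins_pairwise π
  cases h : cycleMins π with
  | nil => simp [h] at h0
  | cons a R =>
    rw [h] at h0 hp
    rw [List.pairwise_cons] at hp
    have ha : a = 0 := by
      rcases List.mem_cons.1 h0 with h0 | h0
      · exact h0.symm
      · exact absurd (hp.1 0 h0) (by simp)
    subst ha
    exact ⟨R, rfl, fun m hm => (hp.1 m hm).ne'⟩

theorem cycleList_eq_cons {n : ℕ} (π : Equiv.Perm (Fin n)) (m : Fin n) :
    cycleList π m = m :: (List.range (minimalPeriod π m - 1)).map (fun k => (π ^ (k + 1)) m) := by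
  have hp := minimalPeriod_pos_of_mem_periodicPts (π.injective.mem_periodicPts m)
  obtain ⟨p, hp⟩ : ∃ p, minimalPeriod π m = p + 1 := ⟨minimalPeriod π m - 1, by omega⟩
  unfold cycleList
  rw [hp, List.range_succ_eq_map]
  simp [Function.comp_def]

/-- Insert the letter `i` right after `0` in the cycle of `0`. -/
def insPerm {n : ℕ} (i : Fin (n + 2)) (σ : Equiv.Perm (Fin (n + 1))) : Equiv.Perm (Fin (n + 2)) :=
  (finSuccEquiv' i).symm.permCongr σ.optionCongr * Equiv.swap 0 i

variable {n : ℕ} (i : Fin (n + 2)) (σ : Equiv.Perm (Fin (n + 1)))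

theorem insPerm_zero : insPerm i σ 0 = i := by
  simp [insPerm]

theorem insPerm_self : insPerm i σ i = i.succAbove (if i = 0 then 0 else σ 0) ∨ i = 0 := by
  by_cases hi : i = 0
  · exact Or.inr hi
  · left
    have h0 : (0 : Fin (n + 2)) = i.succAbove 0 := (Fin.succAbove_ne_zero_zero hi).symm
    have : (finSuccEquiv' i) 0 = some 0 := by
      rw [h0, finSuccEquiv'_succAbove]
    simp [insPerm, hi, this]

theorem insPerm_succAbove (hi : i ≠ 0) (x : Fin (n + 1)) (hx : x ≠ 0) :
    insPerm i σ (i.succAbove x) = i.succAbove (σ x) := by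
  have h1 : i.succAbove x ≠ 0 := Fin.succAbove_ne_zero hi hx
  have h2 : i.succAbove x ≠ i := Fin.succAbove_ne i x
  simp [insPerm, Equiv.swap_apply_of_ne_of_ne h1 h2]

theorem insPerm_i (hi : i ≠ 0) : insPerm i σ i = i.succAbove (σ 0) := by
  rcases insPerm_self i σ with h | h
  · simpa [hi] using h
  · exact absurd h hi

theorem insPerm_injective (hi : i ≠ 0) : Function.Injective (insPerm (n := n) i) := by
  intro σ τ h
  ext1 x
  apply Fin.succAbove_right_injective (p := i)
  by_cases hx : x = 0
  · subst hx; rw [← insPerm_i i σ hi, ← insPerm_i i τ hi, h]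
  · rw [← insPerm_succAbove i σ hi x hx, ← insPerm_succAbove i τ hi x hx, h]

theorem insPerm_surj (π : Equiv.Perm (Fin (n + 2))) (h : π 0 = i) : ∃ σ, insPerm i σ = π := by
  refine ⟨removeNone ((finSuccEquiv' i).permCongr (π * Equiv.swap 0 i)), ?_⟩
  have h1 : ((finSuccEquiv' i).permCongr (π * Equiv.swap 0 i)) none = none := by
    simp [h]
  unfold insPerm
  rw [map_equiv_removeNone, h1, Equiv.swap_self]
  ext x
  simp [Equiv.Perm.mul_apply]


theorem sameCycle_of_step {m : ℕ} (π : Equiv.Perm (Fin m)) (r : Fin m → Fin m → Prop)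
    (hr : ∀ x, r x x) (ht : ∀ x y z, r x y → r y z → r x z)
    (hs : ∀ x, r x (π x)) (x y : Fin m) (h : π.SameCycle x y) : r x y := by
  obtain ⟨k, -, rfl⟩ := h.exists_pow_eq'
  induction k with
  | zero => simpa using hr x
  | succ k ih =>
    rw [pow_succ', Equiv.Perm.mul_apply]
    exact ht _ _ _ (ih ⟨k, by simp⟩) (hs _)

theorem insPerm_sameCycle (hi : i ≠ 0) (x y : Fin (n + 1)) :
    (insPerm i σ).SameCycle (i.succAbove x) (i.succAbove y) ↔ σ.SameCycle x y := by
  have h0 : i.succAbove 0 = 0 := Fin.succAbove_ne_zero_zero hi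
  have h0' : finSuccEquiv' i 0 = some 0 := by
    conv_lhs => rw [← h0]
    exact finSuccEquiv'_succAbove i 0
  constructor
  · intro h
    have := sameCycle_of_step (insPerm i σ)
      (fun a b => σ.SameCycle ((finSuccEquiv' i a).getD 0) ((finSuccEquiv' i b).getD 0))
      (fun a => Equiv.Perm.SameCycle.refl _ _) (fun a b c h1 h2 => h1.trans h2) ?_ _ _ h
    · simpa using this
    · intro a
      by_cases hai : a = i
      · subst hai
        rw [insPerm_i _ _ hi]
        simp [Equiv.Perm.SameCycle.refl]
      · obtain ⟨z, rfl⟩ := Fin.exists_succAbove_eq hai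
        by_cases hz : z = 0
        · subst hz
          rw [h0, insPerm_zero]
          simp [h0', Equiv.Perm.SameCycle.refl]
        · rw [insPerm_succAbove i σ hi z hz]
          simp [Equiv.Perm.SameCycle.refl]
  · refine sameCycle_of_step σ
      (fun a b => (insPerm i σ).SameCycle (i.succAbove a) (i.succAbove b))
      (fun a => Equiv.Perm.SameCycle.refl _ _) (fun a b c h1 h2 => h1.trans h2) ?_ x y
    intro z
    by_cases hz : z = 0
    · subst hz
      rw [← insPerm_i i σ hi, h0, Equiv.Perm.sameCycle_apply_right]
      refine ⟨1, ?_⟩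
      simp [insPerm_zero]
    · rw [← insPerm_succAbove i σ hi z hz]
      simp [Equiv.Perm.SameCycle.refl]

theorem insPerm_cycleMins (hi : i ≠ 0) :
    cycleMins (insPerm i σ) = (cycleMins σ).map i.succAbove := by
  have h0 : i.succAbove 0 = 0 := Fin.succAbove_ne_zero_zero hi
  have hp : ((cycleMins σ).map i.succAbove).Pairwise (· < ·) := by
    rw [List.pairwise_map]
    exact (cycleMins_pairwise σ).imp fun h => Fin.succAbove_lt_succAbove_iff.2 h
  refine List.Perm.eq_of_pairwise (le := (· < ·)) ?_ (cycleMins_pairwise _) hp ?_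
  · intro a b _ _ h1 h2
    exact absurd h1 h2.asymm
  · refine (List.perm_ext_iff_of_nodup ((cycleMins_pairwise _).imp (fun h => h.ne))
      (hp.imp (fun h => h.ne))).2 ?_
    intro a
    rw [mem_cycleMins, List.mem_map]
    constructor
    · intro h
      have hai : a ≠ i := by
        rintro rfl
        have h1 := h 0 (Equiv.Perm.SameCycle.symm ⟨1, by simp [insPerm_zero]⟩)
        exact hi (Fin.le_zero_iff.1 h1)
      obtain ⟨z, rfl⟩ := Fin.exists_succAbove_eq hai
      refine ⟨z, ?_, rfl⟩
      rw [mem_cycleMins]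
      intro y hy
      exact Fin.succAbove_le_succAbove_iff.1 (h _ ((insPerm_sameCycle i σ hi z y).2 hy))
    · rintro ⟨z, hz, rfl⟩ y hy
      rw [mem_cycleMins] at hz
      by_cases hyi : y = i
      · subst hyi
        have h1 : (insPerm y σ).SameCycle 0 y := ⟨1, by simp [insPerm_zero]⟩
        have h2 := hy.trans h1.symm
        rw [← h0, insPerm_sameCycle y σ hi] at h2
        have := Fin.le_zero_iff.1 (hz _ h2)
        subst this
        rw [h0]; exact Fin.zero_le _
      · obtain ⟨w, rfl⟩ := Fin.exists_succAbove_eq hyi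
        rw [insPerm_sameCycle i σ hi] at hy
        exact Fin.succAbove_le_succAbove_iff.2 (hz _ hy)

theorem insPerm_cycleList_ne (hi : i ≠ 0) (x : Fin (n + 1)) (hx : ¬ σ.SameCycle x 0) :
    cycleList (insPerm i σ) (i.succAbove x) = (cycleList σ x).map i.succAbove := by
  have hit : ∀ k : ℕ, (insPerm i σ ^ k) (i.succAbove x) = i.succAbove ((σ ^ k) x) := by
    intro k
    induction k with
    | zero => simp
    | succ k ih =>
      rw [pow_succ', Equiv.Perm.mul_apply, ih, insPerm_succAbove i σ hi, pow_succ',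
        Equiv.Perm.mul_apply]
      intro h
      exact hx ⟨k, by simpa using h⟩
  have hm : minimalPeriod (insPerm i σ) (i.succAbove x) = minimalPeriod σ x := by
    rw [minimalPeriod_eq_minimalPeriod_iff]
    intro k
    unfold IsPeriodicPt IsFixedPt
    rw [Equiv.Perm.iterate_eq_pow, Equiv.Perm.iterate_eq_pow, hit]
    exact Fin.succAbove_right_inj
  unfold cycleList
  rw [hm, List.map_map]
  exact List.map_congr_left fun k _ => hit k

theorem insPerm_cycleList_zero (hi : i ≠ 0) (T : List (Fin (n + 1)))
    (hT : cycleList σ 0 = 0 :: T) :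
    cycleList (insPerm i σ) 0 = 0 :: i :: T.map i.succAbove := by
  have h0 : i.succAbove 0 = 0 := Fin.succAbove_ne_zero_zero hi
  have hp := minimalPeriod_pos_of_mem_periodicPts (σ.injective.mem_periodicPts 0)
  obtain ⟨p, hp⟩ : ∃ p, minimalPeriod σ 0 = p + 1 := ⟨minimalPeriod σ 0 - 1, by omega⟩
  have hne : ∀ k < p, (σ ^ (k + 1)) 0 ≠ 0 := by
    intro k hk h
    exact not_isPeriodicPt_of_pos_of_lt_minimalPeriod (f := σ) (x := 0) (n := k + 1)
      (by omega) (by omega) (by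
        unfold IsPeriodicPt IsFixedPt
        rw [Equiv.Perm.iterate_eq_pow, h])
  have hit : ∀ k ≤ p, (insPerm i σ ^ (k + 2)) 0 = i.succAbove ((σ ^ (k + 1)) 0) := by
    intro k
    induction k with
    | zero =>
      intro _
      simp [pow_two, insPerm_zero, insPerm_i i σ hi]
    | succ k ih =>
      intro hk
      rw [pow_succ', Equiv.Perm.mul_apply, ih (by omega),
        insPerm_succAbove i σ hi _ (hne k (by omega)), pow_succ' σ (k + 1),
        Equiv.Perm.mul_apply]
  have hm : minimalPeriod (insPerm i σ) 0 = p + 2 := by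
    apply le_antisymm
    · apply IsPeriodicPt.minimalPeriod_le (by omega)
      unfold IsPeriodicPt IsFixedPt
      rw [Equiv.Perm.iterate_eq_pow, hit p le_rfl]
      have := isPeriodicPt_minimalPeriod σ 0
      unfold IsPeriodicPt IsFixedPt at this
      rw [hp, Equiv.Perm.iterate_eq_pow] at this
      rw [this, h0]
    · by_contra hlt
      have hq := isPeriodicPt_minimalPeriod (insPerm i σ) 0
      have hq0 := minimalPeriod_pos_of_mem_periodicPts ((insPerm i σ).injective.mem_periodicPts 0)
      generalize minimalPeriod (insPerm i σ) 0 = q at hq hq0 hlt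
      unfold IsPeriodicPt IsFixedPt at hq
      rw [Equiv.Perm.iterate_eq_pow] at hq
      rcases q with _ | _ | k
      · omega
      · simp [insPerm_zero, hi] at hq
      · rw [hit k (by omega), ← h0] at hq
        exact hne k (by omega) (by simpa [h0] using Fin.succAbove_right_injective hq)
  have h1 := cycleList_eq_cons σ 0
  rw [hT, hp] at h1
  have h2 := (List.cons.inj h1).2
  rw [h2]
  unfold cycleList
  rw [hm, List.range_succ_eq_map, List.range_succ_eq_map]
  simp only [List.map_cons, List.map_map, Function.comp_def, Nat.add_sub_cancel]
  simp only [pow_zero, Equiv.Perm.coe_one, id, List.cons.injEq, true_and]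
  refine ⟨by simp [insPerm_zero], List.map_congr_left fun k hk => ?_⟩
  exact hit k (List.mem_range.1 hk).le

theorem insPerm_flatFin (hi : i ≠ 0) :
    ∃ T, flatFin σ = 0 :: T ∧ flatFin (insPerm i σ) = 0 :: i :: T.map i.succAbove := by
  have h0 : i.succAbove 0 = 0 := Fin.succAbove_ne_zero_zero hi
  obtain ⟨R, hR, hR0⟩ := cycleMins_eq_cons σ
  have hT := cycleList_eq_cons σ 0
  generalize (List.range (minimalPeriod σ 0 - 1)).map (fun k => (σ ^ (k + 1)) 0) = T at hT
  refine ⟨T ++ (R.map (cycleList σ)).flatten, ?_, ?_⟩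
  · unfold flatFin
    rw [hR, List.map_cons, List.flatten_cons, hT, List.cons_append]
  · unfold flatFin
    rw [insPerm_cycleMins i σ hi, hR, List.map_cons, List.map_cons, h0, List.flatten_cons,
      insPerm_cycleList_zero i σ hi T hT]
    simp only [List.cons_append, List.map_append, List.map_map, List.map_flatten]
    congr 4
    apply List.map_congr_left
    intro x hx
    apply insPerm_cycleList_ne i σ hi
    intro h
    have hx' : x ∈ cycleMins σ := by rw [hR]; exact List.mem_cons_of_mem _ hx
    rw [mem_cycleMins] at hx'
    exact hR0 x hx (Fin.le_zero_iff.1 (hx' 0 h))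

theorem apply_zero_of_flatFin (hi : 2 ≤ (i : ℕ)) (π : Equiv.Perm (Fin (n + 2)))
    (T : List (Fin (n + 2))) (h : flatFin π = 0 :: i :: T) : π 0 = i := by
  obtain ⟨R, hR, hR0⟩ := cycleMins_eq_cons π
  unfold flatFin at h
  rw [hR, List.map_cons, List.flatten_cons, cycleList_eq_cons] at h
  by_cases hf : π 0 = 0
  · exfalso
    have hper : minimalPeriod π 0 = 1 := minimalPeriod_eq_one_iff_isFixedPt.2 hf
    rw [hper] at h
    have h1 : (1 : Fin (n + 2)) ∈ cycleMins π := by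
      rw [mem_cycleMins]
      intro y hy
      have : y ≠ 0 := by
        rintro rfl
        have := (hy.symm.exists_pow_eq').choose_spec.2
        have h3 : ∀ k : ℕ, (π ^ k) 0 = 0 := by
          intro k
          induction k with
          | zero => simp
          | succ k ih => rw [pow_succ', Equiv.Perm.mul_apply, ih, hf]
        rw [h3] at this
        simp at this
      exact Fin.one_le_of_ne_zero this
    have hpw := cycleMins_pairwise π
    rw [hR] at h1 hpw
    cases R with
    | nil => simp at h1
    | cons a R =>
      rw [List.map_cons, List.flatten_cons, cycleList_eq_cons] at h
      simp at h
      obtain ⟨rfl, -⟩ := h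
      have : a ≤ 1 := by
        rcases List.mem_cons.1 h1 with h1 | h1
        · simp at h1
        · rcases List.mem_cons.1 h1 with h1 | h1
          · exact h1.ge
          · exact ((List.pairwise_cons.1 (List.pairwise_cons.1 hpw).2).1 1 h1).le
      have : (a : ℕ) ≤ 1 := this
      omega
  · have hper : minimalPeriod π 0 ≠ 1 := fun h => hf (minimalPeriod_eq_one_iff_isFixedPt.1 h)
    have hp := minimalPeriod_pos_of_mem_periodicPts (π.injective.mem_periodicPts 0)
    obtain ⟨p, hp⟩ : ∃ p, minimalPeriod π 0 = p + 2 := ⟨minimalPeriod π 0 - 2, by omega⟩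
    rw [hp, show p + 2 - 1 = p + 1 from rfl, List.range_succ_eq_map] at h
    simp at h
    exact h.1


theorem occ_cons_cons (a b : ℕ) (w : List ℕ) :
    occ (a :: b :: w) = w.countP (fun c => a < c ∧ c < b) + occ (b :: w) := by
  have hc : ∀ w : List ℕ, w.countP (fun c => a < c ∧ c < b)
      = ∑ j ∈ Finset.range w.length, if a < w.getD j 0 ∧ w.getD j 0 < b then 1 else 0 := by
    intro w
    induction w with
    | nil => simp
    | cons c w ih =>
      rw [List.countP_cons, ih, List.length_cons, Finset.sum_range_succ']
      simp
  unfold occ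
  rw [hc, Finset.card_filter, Finset.card_filter, Finset.sum_product, Finset.sum_product]
  simp only [List.length_cons]
  rw [Finset.sum_range_succ', Finset.sum_range_succ', Finset.sum_range_succ' _ w.length]
  simp only [Finset.sum_range_succ', Nat.add_sub_cancel]
  simp only [List.getD_cons_succ, List.getD_cons_zero]
  simp
  rw [add_comm]

theorem occ_single (a : ℕ) : occ [a] = 0 := by
  unfold occ
  rw [Finset.card_eq_zero, Finset.filter_eq_empty_iff]
  rintro ⟨x, y⟩ h
  simp only [Finset.mem_product, Finset.mem_range, List.length_singleton] at h
  simp only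
  omega

theorem occ_map (f : ℕ → ℕ) (hf : StrictMono f) (w : List ℕ) : occ (w.map f) = occ w := by
  induction w with
  | nil => rfl
  | cons a w ih =>
    cases w with
    | nil => rw [List.map_cons, List.map_nil, occ_single, occ_single]
    | cons b w =>
      simp only [List.map_cons] at ih ⊢
      rw [occ_cons_cons, occ_cons_cons, ih, List.countP_map]
      simp [Function.comp_def, hf.lt_iff_lt]

theorem countP_split (V : List ℕ) (p q r : ℕ → Bool)
    (h : ∀ c ∈ V, (p c = true ↔ (q c = true ∨ r c = true)) ∧ ¬ (q c = true ∧ r c = true)) :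
    V.countP p = V.countP q + V.countP r := by
  induction V with
  | nil => simp
  | cons c V ih =>
    rw [List.countP_cons, List.countP_cons, List.countP_cons,
      ih fun c hc => h c (List.mem_cons_of_mem _ hc)]
    have := h c (by simp)
    cases hp : p c <;> cases hq : q c <;> cases hr : r c <;> simp_all <;> omega

/-- The shift of letters making room for the letter `I`. -/
def shiftLetter (I c : ℕ) : ℕ := if c < I then c else c + 1

theorem shiftLetter_strictMono (I : ℕ) : StrictMono (shiftLetter I) := by
  intro a b h
  unfold shiftLetter
  split_ifs <;> omega

theorem occ_insert (N I j : ℕ) (V : List ℕ) (hI : 3 ≤ I) (hIN : I ≤ N + 1)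
    (hnd : (1 :: j :: V).Nodup) (hmem : ∀ c, c ∈ 1 :: j :: V ↔ 1 ≤ c ∧ c ≤ N) :
    occ (1 :: I :: (j :: V).map (shiftLetter I)) = occ (1 :: j :: V) + (I - j) := by
  have hj1 : 2 ≤ j := by
    have h1 := (hmem j).1 (by simp)
    have : j ≠ 1 := by rintro rfl; simp at hnd
    omega
  have hjV : ∀ c ∈ V, c ≠ j := by
    rintro c hc rfl
    simp [hc] at hnd
  rw [List.map_cons, occ_cons_cons, occ_cons_cons, ← List.map_cons,
    occ_map _ (shiftLetter_strictMono I), occ_cons_cons 1 j V, List.map_cons, List.countP_cons,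
    List.countP_map, List.countP_map]
  have e1 : V.countP ((fun c => decide (1 < c ∧ c < I)) ∘ shiftLetter I)
      = V.countP (fun c => 1 < c ∧ c < I) := by
    apply List.countP_congr
    intro c _
    simp only [Function.comp, decide_eq_true_eq]
    unfold shiftLetter
    split_ifs <;> omega
  rw [e1]
  by_cases hj : j < I
  · have hs : shiftLetter I j = j := by simp [shiftLetter, hj]
    have e2 : V.countP ((fun c => decide (I < c ∧ c < shiftLetter I j)) ∘ shiftLetter I) = 0 := by
      rw [List.countP_eq_zero]
      intro c _
      simp only [Function.comp, decide_eq_true_eq, hs]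
      omega
    have e3 := countP_split V (fun c => 1 < c ∧ c < I) (fun c => 1 < c ∧ c < j)
      (fun c => j < c ∧ c < I) (by
        intro c hc
        have := hjV c hc
        simp only [decide_eq_true_eq]
        omega)
    have e4 : V.countP (fun c => j < c ∧ c < I) = I - j - 1 := by
      have hV : V.Nodup := (List.nodup_cons.1 (List.nodup_cons.1 hnd).2).2
      rw [List.countP_eq_length_filter, ← List.toFinset_card_of_nodup (hV.filter _),
        ← Nat.card_Ioo]
      congr 1
      ext c
      simp only [List.mem_toFinset, List.mem_filter, decide_eq_true_eq, Finset.mem_Ioo]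
      constructor
      · exact fun h => h.2
      · intro h
        refine ⟨?_, h⟩
        have := (hmem c).2 (by omega)
        simp only [List.mem_cons] at this
        rcases this with h | h | h
        · omega
        · omega
        · exact h
    rw [e2, e3, e4, hs, if_pos (by simp; omega)]
    omega
  · have hs : shiftLetter I j = j + 1 := by simp [shiftLetter, hj]
    have e2 : V.countP ((fun c => decide (I < c ∧ c < shiftLetter I j)) ∘ shiftLetter I)
        = V.countP (fun c => I ≤ c ∧ c < j) := by
      apply List.countP_congr
      intro c _
      simp only [Function.comp, decide_eq_true_eq, hs]
      unfold shiftLetter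
      split_ifs <;> omega
    have e3 := countP_split V (fun c => 1 < c ∧ c < j) (fun c => 1 < c ∧ c < I)
      (fun c => I ≤ c ∧ c < j) (by
        intro c hc
        simp only [decide_eq_true_eq]
        omega)
    rw [e2, e3, hs, if_neg (by simp; omega)]
    omega

theorem flattenPerm_eq {m : ℕ} (π : Equiv.Perm (Fin m)) :
    flattenPerm π = (flatFin π).map (fun x : Fin m => (x : ℕ) + 1) := by
  have h : ∀ L : List (Fin m), List.map (fun k : ℕ => k + 1) (L.flatMap fun a : Fin m => [(a : ℕ)])
      = L.map (fun x : Fin m => (x : ℕ) + 1) := by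
    intro L
    induction L with
    | nil => rfl
    | cons a L ih => simpa using ih
  exact h _

theorem mem_flattenPerm {m : ℕ} (π : Equiv.Perm (Fin m)) (c : ℕ) :
    c ∈ flattenPerm π ↔ 1 ≤ c ∧ c ≤ m := by
  rw [flattenPerm_eq, List.mem_map]
  constructor
  · rintro ⟨x, -, rfl⟩
    have := x.isLt
    omega
  · rintro ⟨h1, h2⟩
    exact ⟨⟨c - 1, by omega⟩, mem_flatFin π _, by simp; omega⟩

theorem flattenPerm_nodup {m : ℕ} (π : Equiv.Perm (Fin m)) : (flattenPerm π).Nodup := by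
  rw [flattenPerm_eq]
  refine (flatFin_nodup π).map ?_
  intro a b h
  ext
  simpa using h

theorem insPerm_flattenPerm (hi : 2 ≤ (i : ℕ)) (hn : 1 ≤ n) :
    ∃ j V, 2 ≤ j ∧ flattenPerm σ = 1 :: j :: V ∧
      [1, (i : ℕ) + 1] <+: flattenPerm (insPerm i σ) ∧
      occ (flattenPerm (insPerm i σ)) = occ (flattenPerm σ) + ((i : ℕ) + 1 - j) := by
  have hi0 : i ≠ 0 := by rintro rfl; simp at hi
  obtain ⟨T, hT, hT'⟩ := insPerm_flatFin i σ hi0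
  have hnd := flattenPerm_nodup σ
  have hmem := mem_flattenPerm σ
  have hs : ∀ x : Fin (n + 1), ((i.succAbove x : Fin (n + 2)) : ℕ) + 1
      = shiftLetter ((i : ℕ) + 1) ((x : ℕ) + 1) := by
    intro x
    unfold shiftLetter Fin.succAbove
    simp only [Fin.lt_def, Fin.val_castSucc, Nat.add_lt_add_iff_right]
    split_ifs <;> simp
  have e2 : flattenPerm (insPerm i σ) = 1 :: ((i : ℕ) + 1) ::
      (T.map (fun x : Fin (n + 1) => (x : ℕ) + 1)).map (shiftLetter ((i : ℕ) + 1)) := by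
    rw [flattenPerm_eq, hT']
    simp [Function.comp_def, hs]
  have e1 : flattenPerm σ = 1 :: T.map (fun x : Fin (n + 1) => (x : ℕ) + 1) := by
    rw [flattenPerm_eq, hT]; simp
  generalize T.map (fun x : Fin (n + 1) => (x : ℕ) + 1) = W at e1 e2
  cases W with
  | nil =>
    have := (hmem 2).2 (by omega)
    simp [e1] at this
  | cons j V =>
    rw [e1] at hnd hmem
    refine ⟨j, V, ?_, e1, ?_, ?_⟩
    · have h1 := (hmem j).1 (by simp)
      have : j ≠ 1 := by rintro rfl; simp at hnd
      omega
    · rw [e2]; simp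
    · rw [e1, e2]
      exact occ_insert (n + 1) _ j V (by omega) (by have := i.isLt; omega) hnd hmem

theorem gPrefix_eq_sum_insPerm (hi : 2 ≤ (i : ℕ)) (hn : 1 ≤ n) :
    gPrefix (n + 2) [1, (i : ℕ) + 1]
      = ∑ σ : Equiv.Perm (Fin (n + 1)), (X : Polynomial ℤ) ^ occ (flattenPerm (insPerm i σ)) := by
  have hi0 : i ≠ 0 := by rintro rfl; simp at hi
  unfold gPrefix
  symm
  refine Finset.sum_nbij (insPerm i) ?_ (insPerm_injective i hi0).injOn ?_ (fun _ _ => rfl)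
  · intro σ _
    obtain ⟨j, V, -, -, h, -⟩ := insPerm_flattenPerm i σ hi hn
    simpa using h
  · intro π hπ
    simp only [Finset.coe_filter, Finset.mem_univ, true_and, Set.mem_ofPred_eq] at hπ
    have h0 : π 0 = i := by
      obtain ⟨V, hV⟩ := hπ
      rw [flattenPerm_eq] at hV
      rcases hF : flatFin π with _ | ⟨a, _ | ⟨b, T⟩⟩
      · simp [hF] at hV
      · simp [hF] at hV
      · rw [hF] at hV
        simp at hV
        obtain ⟨ha, hb, -⟩ := hV
        have hb' : b = i := Fin.ext hb.symm
        subst hb' ha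
        exact apply_zero_of_flatFin b hi π T hF
    obtain ⟨σ, hσ⟩ := insPerm_surj i π h0
    exact ⟨σ, by simp, hσ⟩

end flattenHelpers

/-- For `n ≥ 3` and `3 ≤ i ≤ n`,
`g_n(1i) = g_{n-1} + Σ_{j=2}^{i-1} (q^{i-j} − 1)·g_{n-1}(1j)` in `ℤ[q]`. -/
theorem gPrefix_two_letters (n i : ℕ) (hn : 3 ≤ n) (hi : 3 ≤ i) (hin : i ≤ n) :
    gPrefix n [1, i]
      = gPoly (n - 1) + ∑ j ∈ Finset.Icc 2 (i - 1), (X ^ (i - j) - 1) * gPrefix (n - 1) [1, j] := by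
  obtain ⟨m, rfl⟩ : ∃ m, n = m + 2 := ⟨n - 2, by omega⟩
  obtain ⟨k, rfl⟩ : ∃ k, i = k + 1 := ⟨i - 1, by omega⟩
  have h := gPrefix_eq_sum_insPerm (n := m) ⟨k, by omega⟩ (by simp; omega) (by omega)
  simp only at h
  rw [h, show m + 2 - 1 = m + 1 from rfl]
  unfold gPoly gPrefix
  simp only [Finset.sum_filter, Finset.mul_sum]
  rw [Finset.sum_comm, ← Finset.sum_add_distrib]
  refine Finset.sum_congr rfl fun σ _ => ?_
  obtain ⟨j, V, hj, hσ, -, ho⟩ := insPerm_flattenPerm (n := m) ⟨k, by omega⟩ σ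
    (by simp; omega) (by omega)
  rw [ho]
  have hpre : ∀ l : ℕ, ([1, l] <+: flattenPerm σ) ↔ l = j := by
    intro l
    rw [hσ]
    simp
  simp only [hpre, mul_ite, mul_zero, Finset.sum_ite_eq', Finset.mem_Icc]
  split_ifs with hc
  · rw [pow_add]; ring
  · rw [show k + 1 - j = 0 by omega]; simp
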